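/- Let Ψ be a real Banach space, n ≥ 1 an integer, D an open subset of ℝⁿ × Ψ, F : D → ℝⁿ a continuously Fréchet differentiable map, and z ∈ ℝⁿ. Assume: (i) for every (y,ψ) ∈ D with F(y,ψ) = z, the total derivative DF(y,ψ) : ℝⁿ × Ψ → ℝⁿ is surjective; (ii) there exists a countable family of subsets C_j ⊆ D whose union contains F⁻¹(z), such that for each j the restriction of the projection map (y,ψ) ↦ ψ to F⁻¹(z) ∩ C_j is a proper map. Then the set of parameters ψ ∈ Ψ for which z is a regular value of F(·,ψ) — that is, for every y with (y,ψ) ∈ D and F(y,ψ) = z the partial derivative D_yF(y,ψ) : ℝⁿ → ℝⁿ is surjective — is a residual (comeager) subset of Ψ. -/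

import Mathlib

open Set Filter Topology MeasureTheory

section ParametricSard

variable {X E : Type*} [NormedAddCommGroup X] [NormedSpace ℝ X]
  [NormedAddCommGroup E] [NormedSpace ℝ E] [FiniteDimensional ℝ E]

theorem surjective_comp_inl_of_det_ne_zero {A : X × E →L[ℝ] X} {π : X × E →L[ℝ] E}
    {e : (X × E) ≃L[ℝ] (X × E)} (he : (e : X × E →L[ℝ] X × E) = A.prod π)
    (hdet : ((ContinuousLinearMap.snd ℝ X E).comp
      ((e.symm : X × E →L[ℝ] X × E).comp (ContinuousLinearMap.inr ℝ X E))).det ≠ 0) :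
    Function.Surjective (A.comp (ContinuousLinearMap.inl ℝ X E)) := by
  have hfst : ∀ v, A (e.symm v) = v.1 := fun v ↦ by
    have h := congrArg (fun L : X × E →L[ℝ] X × E ↦ (L (e.symm v)).1) he
    simpa using h.symm
  have hsurj : Function.Surjective fun t : E ↦ (e.symm (0, t)).2 :=
    (LinearMap.equivOfDetNeZero _ hdet).surjective
  intro w
  obtain ⟨t, ht⟩ := hsurj (e.symm (w, 0)).2
  refine ⟨(e.symm (w, 0)).1 - (e.symm (0, t)).1, ?_⟩
  have hsub : ((e.symm (w, 0)).1 - (e.symm (0, t)).1, (0 : E)) =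
      e.symm (w, 0) - e.symm (0, t) := by
    ext
    · rfl
    · exact (sub_eq_zero.2 ht.symm).symm
  rw [ContinuousLinearMap.comp_apply, ContinuousLinearMap.inl_apply, hsub, map_sub, hfst, hfst,
    sub_zero]

variable [FiniteDimensional ℝ X]

/-- A surjective linear map `X × E → X` can be completed to an automorphism of `X × E`. -/
theorem exists_continuousLinearEquiv_eq_prod (A : X × E →L[ℝ] X) (hA : Function.Surjective A) :
    ∃ (π : X × E →L[ℝ] E) (e : (X × E) ≃L[ℝ] (X × E)),
      (e : X × E →L[ℝ] X × E) = A.prod π := by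
  have hdim : Module.finrank ℝ (LinearMap.ker (A : X × E →ₗ[ℝ] X)) = Module.finrank ℝ E := by
    have h := LinearMap.finrank_range_add_finrank_ker (A : X × E →ₗ[ℝ] X)
    rw [LinearMap.range_eq_top.2 hA, finrank_top, Module.finrank_prod] at h
    exact Nat.add_left_cancel h
  let κ := LinearEquiv.ofFinrankEq _ E hdim
  obtain ⟨r, hr⟩ := LinearMap.exists_leftInverse_of_injective
    (LinearMap.ker (A : X × E →ₗ[ℝ] X)).subtype (Submodule.ker_subtype _)
  let π : X × E →L[ℝ] E := LinearMap.toContinuousLinearMap (κ.toLinearMap ∘ₗ r)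
  have hinj : Function.Injective (A.prod π : X × E →ₗ[ℝ] X × E) := by
    rw [← LinearMap.ker_eq_bot, LinearMap.ker_eq_bot']
    intro v hv
    have h₁ : A v = 0 := congrArg Prod.fst hv
    have h₂ : κ (r v) = 0 := congrArg Prod.snd hv
    have h₃ : r v = ⟨v, h₁⟩ := LinearMap.congr_fun hr ⟨v, h₁⟩
    rw [h₃, map_eq_zero_iff κ κ.injective] at h₂
    exact congrArg Subtype.val h₂
  refine ⟨π, (LinearEquiv.ofInjectiveEndo _ hinj).toContinuousLinearEquiv, ?_⟩
  ext v <;> rfl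

variable [MeasurableSpace E] [BorelSpace E] (μ : Measure E) [μ.IsAddHaarMeasure]
  {W : Set (X × E)} {G : X × E → X} {G' : X × E → (X × E →L[ℝ] X)} {z : X}

theorem exists_mem_nhds_measure_singular_parameters_eq_zero (hW : IsOpen W)
    (hG : ∀ p ∈ W, HasFDerivAt G (G' p) p) (hG' : ContinuousOn G' W) {p : X × E} (hp : p ∈ W)
    (hsurj : Function.Surjective (G' p)) :
    ∃ V ∈ 𝓝 p, μ (Prod.snd '' {q | q ∈ V ∧ G q = z ∧
      ¬ Function.Surjective ((G' q).comp (ContinuousLinearMap.inl ℝ X E))}) = 0 := by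
  have : CompleteSpace (X × E) := FiniteDimensional.complete ℝ _
  obtain ⟨π, e, he⟩ := exists_continuousLinearEquiv_eq_prod (G' p) hsurj
  have hWp : W ∈ 𝓝 p := hW.mem_nhds hp
  have hcont : ContinuousAt (fun q ↦ (G' q).prod π) p :=
    ContinuousAt.comp (g := ContinuousLinearMap.prodₗᵢ ℝ) (f := fun q ↦ (G' q, π))
      (LinearIsometryEquiv.continuous _).continuousAt
      ((hG'.continuousAt hWp).prodMk continuousAt_const)
  have hderiv : ∀ q ∈ W, HasFDerivAt (fun q ↦ (G q, π q)) ((G' q).prod π) q := fun q hq ↦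
    (hG q hq).prodMk π.hasFDerivAt
  have hstrict : HasStrictFDerivAt (fun q ↦ (G q, π q)) (e : X × E →L[ℝ] X × E) p := by
    rw [he]
    exact hasStrictFDerivAt_of_hasFDerivAt_of_continuousAt (f' := fun q ↦ (G' q).prod π)
      (eventually_of_mem hWp hderiv) hcont
  have hequiv : ∀ᶠ q in 𝓝 p, (G' q).prod π ∈
      range ((↑) : ((X × E) ≃L[ℝ] (X × E)) → (X × E →L[ℝ] X × E)) :=
    hcont.eventually_mem (he ▸ e.nhds)
  let Φ := hstrict.toOpenPartialHomeomorph _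
  have hΦ : ∀ q, Φ q = (G q, π q) := fun _ ↦ rfl
  have hsource : Φ.source ∈ 𝓝 p :=
    Φ.open_source.mem_nhds hstrict.mem_toOpenPartialHomeomorph_source
  refine ⟨_, inter_mem (inter_mem hWp hsource) hequiv, ?_⟩
  set T : Set E := {t | (z, t) ∈ Φ.target ∧ Φ.symm (z, t) ∈ W ∧
    (G' (Φ.symm (z, t))).prod π ∈
      range ((↑) : ((X × E) ≃L[ℝ] (X × E)) → (X × E →L[ℝ] X × E)) ∧
    ¬ Function.Surjective ((G' (Φ.symm (z, t))).comp (ContinuousLinearMap.inl ℝ X E))}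
  have hchoice : ∀ t, ∃ ε : (X × E) ≃L[ℝ] (X × E), t ∈ T →
      (ε : X × E →L[ℝ] X × E) = (G' (Φ.symm (z, t))).prod π := fun t ↦ by
    by_cases ht : t ∈ T
    · exact ht.2.2.1.imp fun _ h _ ↦ h
    · exact ⟨e, fun h ↦ (ht h).elim⟩
  choose ε hε using hchoice
  have hnull : μ ((fun t ↦ (Φ.symm (z, t)).2) '' T) = 0 := by
    refine addHaar_image_eq_zero_of_det_fderivWithin_eq_zero μ
      (f' := fun t ↦ (ContinuousLinearMap.snd ℝ X E).comp
        (((ε t).symm : X × E →L[ℝ] X × E).comp (ContinuousLinearMap.inr ℝ X E)))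
      (fun t ht ↦ ?_) fun t ht ↦ ?_
    · have hsymm : HasFDerivAt Φ.symm ((ε t).symm : X × E →L[ℝ] X × E) (z, t) := by
        refine Φ.hasFDerivAt_symm ht.1 ?_
        rw [hε t ht]
        exact hderiv _ ht.2.1
      exact ((ContinuousLinearMap.snd ℝ X E).hasFDerivAt.comp t
        (hsymm.comp t (hasFDerivAt_prodMk_right z t))).hasFDerivWithinAt
    · by_contra hdet
      exact ht.2.2.2 (surjective_comp_inl_of_det_ne_zero (hε t ht) hdet)
  refine measure_mono_null ?_ hnull
  rintro _ ⟨q, ⟨⟨⟨hqW, hqs⟩, hqe⟩, hqz, hqn⟩, rfl⟩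
  have hq : Φ.symm (z, π q) = q := by
    rw [← hqz, ← hΦ, Φ.left_inv hqs]
  refine ⟨π q, ⟨?_, ?_⟩, congrArg Prod.snd hq⟩
  · rw [← hqz, ← hΦ]
    exact Φ.map_source hqs
  · rw [hq]
    exact ⟨hqW, hqe, hqn⟩

/-- Parametric Sard theorem: if `z` is a regular value of the `C¹` map `G` on an open set of
`X × E`, then it is a regular value of `G(·, e)` for almost every parameter `e`. -/
theorem measure_singular_parameters_eq_zero (hW : IsOpen W)
    (hG : ∀ p ∈ W, HasFDerivAt G (G' p) p) (hG' : ContinuousOn G' W)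
    (hsurj : ∀ p ∈ W, G p = z → Function.Surjective (G' p)) :
    μ (Prod.snd '' {q | q ∈ W ∧ G q = z ∧
      ¬ Function.Surjective ((G' q).comp (ContinuousLinearMap.inl ℝ X E))}) = 0 := by
  have : ProperSpace (X × E) := FiniteDimensional.proper ℝ _
  set S := {q | q ∈ W ∧ G q = z ∧
    ¬ Function.Surjective ((G' q).comp (ContinuousLinearMap.inl ℝ X E))}
  have hlocal : ∀ p, ∃ V : Set (X × E), p ∈ S →
      V ∈ 𝓝 p ∧ μ (Prod.snd '' (V ∩ S)) = 0 := fun p ↦ by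
    by_cases hp : p ∈ S
    · obtain ⟨V, hV, hV₀⟩ := exists_mem_nhds_measure_singular_parameters_eq_zero
        (z := z) μ hW hG hG'
        hp.1 (hsurj p hp.1 hp.2.1)
      exact ⟨V, fun _ ↦ ⟨hV, measure_mono_null
        (image_mono (inter_subset_inter_right V fun _ hq ↦ hq.2)) hV₀⟩⟩
    · exact ⟨univ, fun h ↦ (hp h).elim⟩
  choose V hV using hlocal
  obtain ⟨t, htS, ht, hcover⟩ := TopologicalSpace.countable_cover_nhdsWithin
    (f := V) (s := S) fun p hp ↦ mem_nhdsWithin_of_mem_nhds (hV p hp).1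
  refine measure_mono_null (t := ⋃ p ∈ t, Prod.snd '' (V p ∩ S)) ?_
    ((measure_biUnion_null_iff ht).2 fun p hp ↦ (hV p (htS hp)).2)
  rintro _ ⟨q, hq, rfl⟩
  obtain ⟨p, hp, hqp⟩ := mem_iUnion₂.1 (hcover hq)
  exact mem_iUnion₂.2 ⟨p, hp, q, ⟨hqp, hq⟩, rfl⟩

end ParametricSard

/-- If `F'` is continuous and surjective on a compact set, then on a neighbourhood of this set
it remains surjective when restricted to finitely many parameter directions. -/
theorem exists_finiteDimensional_surjective_of_isCompact
    {X Ψ : Type*} [NormedAddCommGroup X] [NormedSpace ℝ X] [FiniteDimensional ℝ X]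
    [NormedAddCommGroup Ψ] [NormedSpace ℝ Ψ] {D K : Set (X × Ψ)} (hD : IsOpen D)
    {F' : X × Ψ → (X × Ψ →L[ℝ] X)} (hF' : ContinuousOn F' D) (hK : IsCompact K) (hKD : K ⊆ D)
    (hsurj : ∀ p ∈ K, Function.Surjective (F' p)) :
    ∃ (E : Submodule ℝ Ψ) (U : Set (X × Ψ)), FiniteDimensional ℝ E ∧ IsOpen U ∧ K ⊆ U ∧ U ⊆ D ∧
      ∀ p ∈ U, ∀ w, ∃ (y : X) (e : Ψ), e ∈ E ∧ F' p (y, e) = w := by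
  have : CompleteSpace X := FiniteDimensional.complete ℝ X
  refine hK.induction_on (p := fun s ↦ ∃ (E : Submodule ℝ Ψ) (U : Set (X × Ψ)),
    FiniteDimensional ℝ E ∧ IsOpen U ∧ s ⊆ U ∧ U ⊆ D ∧
      ∀ p ∈ U, ∀ w, ∃ (y : X) (e : Ψ), e ∈ E ∧ F' p (y, e) = w) ?_ ?_ ?_ ?_
  · exact ⟨⊥, ∅, inferInstance, isOpen_empty, Subset.rfl, empty_subset _, fun _ h ↦ h.elim⟩
  · rintro s t hst ⟨E, U, hE, hU, htU, h⟩
    exact ⟨E, U, hE, hU, hst.trans htU, h⟩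
  · rintro s t ⟨E₁, U₁, _, hU₁, hs, hUD₁, h₁⟩ ⟨E₂, U₂, _, hU₂, ht, hUD₂, h₂⟩
    refine ⟨E₁ ⊔ E₂, U₁ ∪ U₂, inferInstance, hU₁.union hU₂, union_subset_union hs ht,
      union_subset hUD₁ hUD₂, ?_⟩
    rintro p (hp | hp) w
    · obtain ⟨y, e, he, h⟩ := h₁ p hp w
      exact ⟨y, e, Submodule.mem_sup_left he, h⟩
    · obtain ⟨y, e, he, h⟩ := h₂ p hp w
      exact ⟨y, e, Submodule.mem_sup_right he, h⟩
  · intro p hp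
    obtain ⟨r, hr⟩ := (F' p : X × Ψ →ₗ[ℝ] X).exists_rightInverse_of_surjective
      (LinearMap.range_eq_top.2 (hsurj p hp))
    let R : X →L[ℝ] X × Ψ := LinearMap.toContinuousLinearMap r
    have hR : (F' p).comp R = (ContinuousLinearEquiv.refl ℝ X : X →L[ℝ] X) := by
      ext w
      exact LinearMap.congr_fun hr w
    have hcont : ContinuousOn (fun q ↦ (F' q).comp R) D := hF'.clm_comp continuousOn_const
    have hopen : IsOpen (D ∩ (fun q ↦ (F' q).comp R) ⁻¹'
        range ((↑) : (X ≃L[ℝ] X) → (X →L[ℝ] X))) :=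
      hcont.isOpen_inter_preimage hD ContinuousLinearEquiv.isOpen
    have hmem : p ∈ D ∩ (fun q ↦ (F' q).comp R) ⁻¹'
        range ((↑) : (X ≃L[ℝ] X) → (X →L[ℝ] X)) := ⟨hKD hp, _, hR.symm⟩
    refine ⟨_, mem_nhdsWithin_of_mem_nhds (hopen.mem_nhds hmem),
      LinearMap.range (LinearMap.snd ℝ X Ψ ∘ₗ r), _, inferInstance, hopen, Subset.rfl,
      inter_subset_left, ?_⟩
    rintro q ⟨-, e, he⟩ w
    refine ⟨(r (e.symm w)).1, (r (e.symm w)).2, ⟨e.symm w, rfl⟩, ?_⟩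
    have h := congrArg (fun L : X →L[ℝ] X ↦ L (e.symm w)) he
    simpa [R] using h.symm

/-- The projection to the parameter space is a closed map on a set over which compact sets of
parameters have compact preimage. -/
theorem isClosed_image_snd_diff {X Y : Type*} [TopologicalSpace X] [TopologicalSpace Y]
    [T2Space Y] [CompactlyCoherentSpace Y] {A U : Set (X × Y)}
    (hA : ∀ K : Set Y, IsCompact K → IsCompact {p | p ∈ A ∧ p.2 ∈ K}) (hU : IsOpen U) :
    IsClosed (Prod.snd '' (A \ U)) := by
  have hproper : IsProperMap fun p : A ↦ (p : X × Y).2 := by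
    refine isProperMap_iff_isCompact_preimage.2 ⟨by fun_prop, fun K hK ↦ ?_⟩
    rw [Subtype.isCompact_iff]
    convert hA K hK
    ext p
    simp [and_comm]
  convert hproper.isClosedMap _ (hU.isClosed_compl.preimage continuous_subtype_val) using 1
  ext y
  simp [and_comm]

/-- If `A` is a subset of a regular level set of `F` whose projection to the parameter space is
proper, then the parameters `ψ` for which `F(·, ψ)` is regular along `A` are dense. -/
theorem dense_regular_parameters
    {X Ψ : Type*} [NormedAddCommGroup X] [NormedSpace ℝ X] [FiniteDimensional ℝ X]
    [NormedAddCommGroup Ψ] [NormedSpace ℝ Ψ] {D A : Set (X × Ψ)} (hD : IsOpen D)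
    {F : X × Ψ → X} {F' : X × Ψ → (X × Ψ →L[ℝ] X)} (hF : ∀ p ∈ D, HasFDerivAt F (F' p) p)
    (hF' : ContinuousOn F' D) {z : X} (hAD : A ⊆ D) (hAz : ∀ p ∈ A, F p = z)
    (hsurj : ∀ p ∈ A, Function.Surjective (F' p))
    (hproper : ∀ K : Set Ψ, IsCompact K → IsCompact {p | p ∈ A ∧ p.2 ∈ K}) :
    Dense (Prod.snd '' {p | p ∈ A ∧
      ¬ Function.Surjective ((F' p).comp (ContinuousLinearMap.inl ℝ X Ψ))})ᶜ := by
  rw [dense_iff_inter_open]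
  rintro O hO ⟨ψ₀, hψ₀⟩
  obtain ⟨E, U, hE, hU, hKU, hUD, hUE⟩ := exists_finiteDimensional_surjective_of_isCompact hD hF'
    (hproper {ψ₀} isCompact_singleton) (fun p hp ↦ hAD hp.1) fun p hp ↦ hsurj p hp.1
  have hN : IsOpen (Prod.snd '' (A \ U))ᶜ := (isClosed_image_snd_diff hproper hU).isOpen_compl
  have hψ₀N : ψ₀ ∈ (Prod.snd '' (A \ U))ᶜ := by
    rintro ⟨p, ⟨hpA, hpU⟩, hp⟩
    exact hpU (hKU ⟨hpA, hp⟩)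
  let J : X × E → X × Ψ := fun q ↦ (q.1, ψ₀ + q.2)
  let J' : X × E →L[ℝ] X × Ψ := (ContinuousLinearMap.id ℝ X).prodMap E.subtypeL
  have hJ : Continuous J := by fun_prop
  have hJ' : ∀ q, HasFDerivAt J J' q := fun q ↦ by
    convert! (J'.hasFDerivAt (x := q)).const_add ((0, ψ₀) : X × Ψ) using 1
    ext v <;> simp [J, J']
  let _ : MeasurableSpace E := borel E
  have _ : BorelSpace E := ⟨rfl⟩
  have hnull := measure_singular_parameters_eq_zero (Measure.addHaar : Measure E) (z := z)
    (W := J ⁻¹' U) (G := F ∘ J) (G' := fun q ↦ (F' (J q)).comp J') (hU.preimage hJ)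
    (fun q hq ↦ (hF _ (hUD hq)).comp q (hJ' q))
    ((hF'.comp hJ.continuousOn fun q hq ↦ hUD hq).clm_comp continuousOn_const)
    fun q hq _ w ↦ by
      obtain ⟨y, e, he, h⟩ := hUE _ hq w
      exact ⟨(y, ⟨e, he⟩), h⟩
  have hdense := Measure.dense_of_ae (measure_eq_zero_iff_ae_notMem.1 hnull)
  obtain ⟨e, ⟨heO, heN⟩, he⟩ := hdense.inter_open_nonempty
    ((fun e : E ↦ ψ₀ + (e : Ψ)) ⁻¹' (O ∩ (Prod.snd '' (A \ U))ᶜ))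
    ((hO.inter hN).preimage (by fun_prop))
    ⟨0, by simpa only [mem_preimage, ZeroMemClass.coe_zero, add_zero] using ⟨hψ₀, hψ₀N⟩⟩
  refine ⟨ψ₀ + e, heO, ?_⟩
  rintro ⟨⟨y, ψ⟩, ⟨hA, hns⟩, rfl : ψ = ψ₀ + e⟩
  have hyU : (y, ψ₀ + (e : Ψ)) ∈ U := by
    by_contra hyU
    exact heN ⟨_, ⟨hA, hyU⟩, rfl⟩
  refine he ⟨(y, e), ⟨hyU, hAz _ hA, fun hs ↦ hns ?_⟩, rfl⟩
  convert hs using 2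
  ext v
  simp [J, J']


/-- Henry's transversality theorem (finite-dimensional target case):
if `F : D ⊆ ℝⁿ × Ψ → ℝⁿ` is `C¹`, its total derivative is surjective at every
point of `F⁻¹(z)`, and `F⁻¹(z)` is covered by countably many sets on which the
projection to the parameter `ψ` is proper, then the set of parameters `ψ` for
which `z` is a regular value of `F(·, ψ)` is residual in `Ψ`. -/
theorem henry_transversality_findim
    {n : ℕ} (hn : 1 ≤ n)
    {Ψ : Type*} [NormedAddCommGroup Ψ] [NormedSpace ℝ Ψ] [CompleteSpace Ψ]
    (D : Set ((Fin n → ℝ) × Ψ)) (hD : IsOpen D)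
    (F : (Fin n → ℝ) × Ψ → (Fin n → ℝ))
    (F' : (Fin n → ℝ) × Ψ → ((Fin n → ℝ) × Ψ →L[ℝ] (Fin n → ℝ)))
    (hF : ∀ p ∈ D, HasFDerivAt F (F' p) p)
    (hF' : ContinuousOn F' D)
    (z : Fin n → ℝ)
    (hsurj : ∀ p ∈ D, F p = z → Function.Surjective (F' p))
    (C : ℕ → Set ((Fin n → ℝ) × Ψ))
    (hC : ∀ j, C j ⊆ D)
    (hcover : {p | p ∈ D ∧ F p = z} ⊆ ⋃ j, C j)
    (hproper : ∀ j, ∀ K : Set Ψ, IsCompact K →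
      IsCompact {p | (p ∈ D ∧ F p = z) ∧ p ∈ C j ∧ p.2 ∈ K}) :
    {ψ : Ψ | ∀ y : Fin n → ℝ, (y, ψ) ∈ D → F (y, ψ) = z →
      Function.Surjective ((F' (y, ψ)).comp (ContinuousLinearMap.inl ℝ (Fin n → ℝ) Ψ))}
      ∈ residual Ψ := by
  have hopen : IsOpen {A : (Fin n → ℝ) →L[ℝ] (Fin n → ℝ) | Function.Surjective A} := by
    convert ContinuousLinearEquiv.isOpen (𝕜 := ℝ) (E := Fin n → ℝ) (F := Fin n → ℝ) using 1
    ext A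
    refine ⟨fun hA ↦ ?_, ?_⟩
    · exact ⟨(LinearEquiv.ofInjectiveEndo (A : (Fin n → ℝ) →ₗ[ℝ] (Fin n → ℝ))
        (LinearMap.injective_iff_surjective.2 hA)).toContinuousLinearEquiv, by ext; rfl⟩
    · rintro ⟨e, rfl⟩
      exact e.surjective
  let A : ℕ → Set ((Fin n → ℝ) × Ψ) := fun j ↦ {p | (p ∈ D ∧ F p = z) ∧ p ∈ C j}
  have hA : ∀ j, ∀ K : Set Ψ, IsCompact K → IsCompact {p | p ∈ A j ∧ p.2 ∈ K} := fun j K hK ↦ by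
    simpa only [A, mem_ofPred_eq, and_assoc] using hproper j K hK
  let P : (Fin n → ℝ) × Ψ → Prop := fun p ↦
    Function.Surjective ((F' p).comp (ContinuousLinearMap.inl ℝ (Fin n → ℝ) Ψ))
  have hregular : IsOpen (D ∩ {p | P p}) :=
    (hF'.clm_comp continuousOn_const).isOpen_inter_preimage hD hopen
  have hresidual : ∀ j, (Prod.snd '' {p | p ∈ A j ∧ ¬ P p})ᶜ ∈ residual Ψ := fun j ↦ by
    refine residual_of_dense_open ?_ ?_
    · rw [isOpen_compl_iff]
      convert isClosed_image_snd_diff (hA j) hregular using 2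
      ext p
      exact and_congr_right fun hp ↦ ⟨fun h h' ↦ h h'.2, fun h h' ↦ h ⟨hp.1.1, h'⟩⟩
    · exact dense_regular_parameters hD hF hF' (fun p hp ↦ hp.1.1) (fun p hp ↦ hp.1.2)
        (fun p hp ↦ hsurj p hp.1.1 hp.1.2) (hA j)
  filter_upwards [countable_iInter_mem.2 hresidual] with ψ hψ y hy hyz
  obtain ⟨j, hj⟩ := mem_iUnion.1 (hcover ⟨hy, hyz⟩)
  by_contra hns
  exact mem_iInter.1 hψ j ⟨(y, ψ), ⟨⟨⟨hy, hyz⟩, hj⟩, hns⟩, rfl⟩
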